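/- Let p = rur. Then for all integers n ≥ 1 and m ≥ max(n, 2): s_p(n, m) = s_p(n, m−1) + s_p(n−1, m) − s_p(n−1, m−1) + s_p(n−1, m−2). -/

import Mathlib

/-- A step of a lattice path: `u` (up) or `r` (right). -/
inductive Step : Type
  | u : Step
  | r : Step
deriving DecidableEq

/-- A word over the alphabet `{u, r}`. -/
abbrev Word := List Step

/-- The number of letters `r` in a word. -/
def countR (w : Word) : ℕ := w.count Step.r

/-- The number of letters `u` in a word. -/
def countU (w : Word) : ℕ := w.count Step.u

/-- `dval q` = (number of `r`'s in `q`) - (number of `u`'s in `q`). -/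
def dval (w : Word) : ℤ := (countR w : ℤ) - (countU w : ℤ)

/-- A pattern is depth-zero if every suffix `q` of it satisfies `dval q ≥ 0`. -/
def DepthZero (p : Word) : Prop := ∀ q : Word, q <:+ p → 0 ≤ dval q

/-- `o` is a bifix of `p`: a nonempty proper prefix of `p` that is also a (proper) suffix. -/
def IsBifix (o p : Word) : Prop := o ≠ [] ∧ o ≠ p ∧ o <+: p ∧ o <:+ p

/-- A pattern is bifix-free if it has no bifix. -/
def BifixFree (p : Word) : Prop := ∀ o : Word, ¬ IsBifix o p

/-- `w` is a ballot path to the lattice point `(n, m)`: it has exactly `n` letters `r`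
and `m` letters `u`, and every prefix has at least as many `u`'s as `r`'s. -/
def IsBallot (w : Word) (n m : ℤ) : Prop :=
  (countR w : ℤ) = n ∧ (countU w : ℤ) = m ∧
    ∀ t : Word, t <+: w → countR t ≤ countU t

/-- `w` avoids the pattern `p`: `p` does not occur in `w` as a contiguous substring. -/
def Avoids (p w : Word) : Prop := ¬ p <:+: w

/-- `s p n m` is the number of ballot paths to `(n, m)` avoiding `p`
(`0` if `n < 0`, `m < 0`, or `m < n`, since then no such path exists). -/
noncomputable def s (p : Word) (n m : ℤ) : ℕ :=
  Set.ncard {w : Word | IsBallot w n m ∧ Avoids p w}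

/-- The pattern `rur`. -/
def rur : Word := [Step.r, Step.u, Step.r]

/-- The set of ballot paths to `(n, m)` avoiding `rur`. -/
def paths (n m : ℤ) : Set Word := {w | IsBallot w n m ∧ Avoids rur w}

/-- The paths of `paths n m` whose last letter is `r`. -/
def pathsEndingR (n m : ℤ) : Set Word := {w | w ∈ paths n m ∧ [Step.r] <:+ w}

/-- The paths of `paths n m` that do not end in `ru`. -/
def pathsNotEndingRU (n m : ℤ) : Set Word :=
  {w | w ∈ paths n m ∧ ¬ [Step.r, Step.u] <:+ w}

theorem length_eq_countU_add_countR (w : Word) : w.length = countU w + countR w := by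
  induction w with
  | nil => rfl
  | cons a w ih => cases a <;> simp_all [countU, countR] <;> omega

theorem finite_paths (n m : ℤ) : (paths n m).Finite := by
  have : Finite Step :=
    Finite.of_surjective (fun b : Bool => if b then Step.u else Step.r) fun x => by
      cases x
      · exact ⟨true, rfl⟩
      · exact ⟨false, rfl⟩
  refine (List.finite_length_eq Step (n + m).toNat).subset fun w hw => ?_
  have h := length_eq_countU_add_countR w
  obtain ⟨⟨h1, h2, -⟩, -⟩ := hw
  simp only [Set.mem_ofPred_eq]
  omega

theorem concat_injective (a : Step) : Function.Injective fun w : Word => w ++ [a] :=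
  fun _ _ h => List.append_cancel_right h

theorem isBallot_concat_u (w : Word) (n m : ℤ) :
    IsBallot (w ++ [Step.u]) n m ↔ IsBallot w n (m - 1) := by
  simp only [IsBallot, List.prefix_concat_iff]
  have h1 : countR (w ++ [Step.u]) = countR w := by simp [countR]
  have h2 : countU (w ++ [Step.u]) = countU w + 1 := by simp [countU]
  rw [h1, h2]
  refine ⟨fun ⟨a, b, c⟩ => ⟨a, by omega, fun t ht => c t (.inr ht)⟩,
    fun ⟨a, b, c⟩ => ⟨a, by omega, ?_⟩⟩
  rintro t (rfl | ht)
  · have := c w List.prefix_rfl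
    omega
  · exact c t ht

theorem isBallot_concat_r (w : Word) {n m : ℤ} (hnm : n ≤ m) :
    IsBallot (w ++ [Step.r]) n m ↔ IsBallot w (n - 1) m := by
  simp only [IsBallot, List.prefix_concat_iff]
  have h1 : countR (w ++ [Step.r]) = countR w + 1 := by simp [countR]
  have h2 : countU (w ++ [Step.r]) = countU w := by simp [countU]
  rw [h1, h2]
  refine ⟨fun ⟨a, b, c⟩ => ⟨by omega, b, fun t ht => c t (.inr ht)⟩,
    fun ⟨a, b, c⟩ => ⟨by omega, b, ?_⟩⟩
  rintro t (rfl | ht)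
  · omega
  · exact c t ht

theorem suffix_concat_iff (l w : Word) (a b : Step) :
    l ++ [a] <:+ w ++ [b] ↔ l <:+ w ∧ a = b := by
  constructor
  · rintro ⟨t, ht⟩
    rw [← List.append_assoc] at ht
    obtain ⟨h1, h2⟩ := List.append_inj' ht rfl
    exact ⟨⟨t, h1⟩, by simpa using h2⟩
  · rintro ⟨⟨t, rfl⟩, rfl⟩
    exact ⟨t, by simp⟩

theorem avoids_rur_concat_u (w : Word) : Avoids rur (w ++ [Step.u]) ↔ Avoids rur w := by
  have h := suffix_concat_iff [Step.r, Step.u] w Step.r Step.u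
  simp only [List.cons_append, List.nil_append, reduceCtorEq, and_false, iff_false] at h
  simp [Avoids, List.infix_concat_iff, rur, h]

theorem avoids_rur_concat_r (w : Word) :
    Avoids rur (w ++ [Step.r]) ↔ Avoids rur w ∧ ¬ [Step.r, Step.u] <:+ w := by
  have h := suffix_concat_iff [Step.r, Step.u] w Step.r Step.r
  simp only [List.cons_append, List.nil_append, and_true] at h
  simp [Avoids, List.infix_concat_iff, rur, h, and_comm]

theorem concat_u_mem_paths (w : Word) (n m : ℤ) :
    w ++ [Step.u] ∈ paths n m ↔ w ∈ paths n (m - 1) :=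
  and_congr (isBallot_concat_u w n m) (avoids_rur_concat_u w)

theorem concat_r_mem_paths (w : Word) {n m : ℤ} (hnm : n ≤ m) :
    w ++ [Step.r] ∈ paths n m ↔ w ∈ pathsNotEndingRU (n - 1) m := by
  simp only [paths, pathsNotEndingRU, Set.mem_ofPred_eq, isBallot_concat_r w hnm,
    avoids_rur_concat_r, and_assoc]

theorem ncard_paths_eq_add_ncard_pathsEndingR (n : ℤ) {m : ℤ} (hm : 1 ≤ m) :
    (paths n m).ncard = (paths n (m - 1)).ncard + (pathsEndingR n m).ncard := by
  have hunion : paths n m = (fun w => w ++ [Step.u]) '' paths n (m - 1) ∪ pathsEndingR n m := by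
    ext w
    rcases List.eq_nil_or_concat' w with rfl | ⟨v, a, rfl⟩
    · have : ([] : Word) ∉ paths n m := by
        rintro ⟨⟨-, h, -⟩, -⟩
        simp only [countU, List.count_nil, Nat.cast_zero] at h
        omega
      simp [this, pathsEndingR]
    · have h := suffix_concat_iff [] v Step.r a
      simp only [List.nil_append, List.nil_suffix, true_and] at h
      cases a <;> simp [pathsEndingR, h, concat_u_mem_paths]
  have hdisj : Disjoint ((fun w => w ++ [Step.u]) '' paths n (m - 1)) (pathsEndingR n m) := by
    rw [Set.disjoint_left]
    rintro _ ⟨v, -, rfl⟩ ⟨-, h⟩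
    exact absurd ((suffix_concat_iff [] v Step.r Step.u).1 h).2 (by simp)
  rw [hunion, Set.ncard_union_eq hdisj ((finite_paths _ _).image _)
    ((finite_paths n m).subset fun _ h => h.1),
    Set.ncard_image_of_injective _ (concat_injective _)]

theorem ncard_pathsEndingR {n m : ℤ} (hnm : n ≤ m) :
    (pathsEndingR n m).ncard = (pathsNotEndingRU (n - 1) m).ncard := by
  have himage : pathsEndingR n m = (fun w => w ++ [Step.r]) '' pathsNotEndingRU (n - 1) m := by
    ext w
    constructor
    · rintro ⟨hw, v, rfl⟩
      exact ⟨v, (concat_r_mem_paths v hnm).1 hw, rfl⟩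
    · rintro ⟨v, hv, rfl⟩
      exact ⟨(concat_r_mem_paths v hnm).2 hv, List.suffix_append _ _⟩
  rw [himage, Set.ncard_image_of_injective _ (concat_injective _)]

theorem ncard_paths_eq_pathsNotEndingRU_add (n m : ℤ) :
    (paths n m).ncard = (pathsNotEndingRU n m).ncard + (pathsEndingR n (m - 1)).ncard := by
  have hunion : paths n m =
      pathsNotEndingRU n m ∪ (fun w => w ++ [Step.u]) '' pathsEndingR n (m - 1) := by
    ext w
    constructor
    · intro hw
      by_cases h : [Step.r, Step.u] <:+ w
      · obtain ⟨v, rfl⟩ := h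
        have hv : v ++ [Step.r, Step.u] = (v ++ [Step.r]) ++ [Step.u] := by simp
        rw [hv] at hw ⊢
        exact .inr ⟨_, ⟨(concat_u_mem_paths _ n m).1 hw, List.suffix_append _ _⟩, rfl⟩
      · exact .inl ⟨hw, h⟩
    · rintro (h | ⟨v, ⟨hv, -⟩, rfl⟩)
      · exact h.1
      · exact (concat_u_mem_paths v n m).2 hv
  have hdisj : Disjoint (pathsNotEndingRU n m)
      ((fun w => w ++ [Step.u]) '' pathsEndingR n (m - 1)) := by
    rw [Set.disjoint_right]
    rintro _ ⟨v, ⟨-, hv⟩, rfl⟩ ⟨-, h⟩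
    exact h ((suffix_concat_iff [Step.r] v Step.u Step.u).2 ⟨hv, rfl⟩)
  rw [hunion, Set.ncard_union_eq hdisj ((finite_paths n m).subset fun _ h => h.1)
    (((finite_paths n (m - 1)).subset fun _ h => h.1).image _),
    Set.ncard_image_of_injective _ (concat_injective _)]

/-- Recurrence for ballot paths avoiding `rur`: for integers `n ≥ 1` and `m ≥ max(n, 2)`,
`s rur n m = s rur n (m-1) + s rur (n-1) m - s rur (n-1) (m-1) + s rur (n-1) (m-2)`. -/
theorem recurrence_avoiding_rur (n m : ℤ) (hn : 1 ≤ n) (hm : max n 2 ≤ m) :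
    (s rur n m : ℤ) = (s rur n (m - 1) : ℤ) + (s rur (n - 1) m : ℤ)
      - (s rur (n - 1) (m - 1) : ℤ) + (s rur (n - 1) (m - 2) : ℤ) := by
  have h1 := ncard_paths_eq_add_ncard_pathsEndingR n (m := m) (by omega)
  have h2 := ncard_pathsEndingR (n := n) (m := m) (by omega)
  have h3 := ncard_paths_eq_pathsNotEndingRU_add (n - 1) m
  have h4 := ncard_paths_eq_add_ncard_pathsEndingR (n - 1) (m := m - 1) (by omega)
  rw [show m - 1 - 1 = m - 2 by ring] at h4
  have hs : ∀ a b : ℤ, s rur a b = (paths a b).ncard := fun _ _ => rfl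
  simp only [hs]
  omega
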